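/- Consider the acyclic causal model M with one exogenous variable whose value determines the values of the binary endogenous variables A and B directly, binary endogenous variables C_1, C_2, WIN, and structural equations C_1 = min(A,B), C_2 = min(A,B), and WIN = 1 iff A = 1 or (C_1 = 1 and C_2 = 1) (and WIN = 0 otherwise). Let u⃗ be the context in which A = 1 and B = 1. Then C_1 = 1 ∧ C_2 = 1 is an actual cause of WIN = 1 in (M,u⃗) according to the HP definition, but neither C_1 = 1 alone nor C_2 = 1 alone is an actual cause of WIN = 1 in (M,u⃗). Hence a cause according to the HP definition need not be a single conjunct. -/

import Mathlib

open scoped Classical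

/-- A causal model: for each endogenous variable `X`, a structural equation `F X`
computing the value of `X` from the values of the exogenous variables and of the
(other) endogenous variables. -/
structure CausalModel (U : Type) (RU : U → Type) (V : Type) (R : V → Type) where
  F : (X : V) → ((u : U) → RU u) → ((Y : V) → R Y) → R X

/-- A context: an assignment of values to the exogenous variables. -/
def Ctx (U : Type) (RU : U → Type) : Type := (u : U) → RU u

/-- A world: an assignment of values to the endogenous variables. -/
def World (V : Type) (R : V → Type) : Type := (X : V) → R X

variable {U : Type} {RU : U → Type} {V : Type} {R : V → Type}

/-- `v` is a solution of the structural equations of `M` in context `u`. -/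
def Solves (M : CausalModel U RU V R) (u : Ctx U RU) (v : World V R) : Prop :=
  ∀ X, v X = M.F X u v

/-- `M` is acyclic: there is a strict total order on the endogenous variables such
that `F X` does not depend on the value of `Y` unless `Y ≺ X`. -/
def CausalModel.Acyclic (M : CausalModel U RU V R) : Prop :=
  ∃ lt : V → V → Prop, IsStrictTotalOrder V lt ∧
    ∀ X Y : V, ¬ lt Y X →
      ∀ (u : Ctx U RU) (v : World V R) (y : R Y),
        M.F X u (Function.update v Y y) = M.F X u v

/-- A partial assignment of values to endogenous variables (an intervention). -/
def PAssign (V : Type) (R : V → Type) : Type := (X : V) → Option (R X)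

/-- The partial assignment setting the variables in `A` to the values given by `w`. -/
noncomputable def restrictTo (A : Set V) (w : World V R) : PAssign V R :=
  fun X => if X ∈ A then some (w X) else none

/-- Combination of partial assignments, with priority to the first. -/
def PAssign.union (g h : PAssign V R) : PAssign V R :=
  fun X => (g X).orElse (fun _ => h X)

/-- The partial assignment setting the single variable `X` to `x`. -/
noncomputable def PAssign.single (X : V) (x : R X) : PAssign V R :=
  fun Y => if h : X = Y then some (h ▸ x) else none

/-- The intervened model `M_{g}`: variables in the domain of `g` get the constant
equation given by `g`; the others keep their equation from `M`. -/
def intervene (M : CausalModel U RU V R) (g : PAssign V R) : CausalModel U RU V R where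
  F := fun X u v => (g X).elim (M.F X u v) id

/-- Causal formulas: primitive events `X = x`, Boolean combinations, and
intervention formulas `[Y⃗ ← y⃗]φ`. -/
inductive CForm (V : Type) (R : V → Type) : Type where
  | prim (X : V) (x : R X)
  | neg (φ : CForm V R)
  | conj (φ ψ : CForm V R)
  | intv (g : PAssign V R) (φ : CForm V R)

/-- A formula is an event if it is a Boolean combination of primitive events
(no interventions). -/
def CForm.IsEvent : CForm V R → Prop
  | .prim _ _ => True
  | .neg φ => φ.IsEvent
  | .conj φ ψ => φ.IsEvent ∧ ψ.IsEvent
  | .intv _ _ => False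

/-- The endogenous variables mentioned in a formula. -/
def CForm.vars : CForm V R → Set V
  | .prim X _ => {X}
  | .neg φ => φ.vars
  | .conj φ ψ => φ.vars ∪ ψ.vars
  | .intv g φ => {X | g X ≠ none} ∪ φ.vars

/-- Satisfaction of causal formulas: `(M,u) ⊨ X = x` iff `X` has value `x` in the
(unique, for acyclic models) solution; `(M,u) ⊨ [g]φ` iff `(M_g, u) ⊨ φ`. -/
def Sat : CausalModel U RU V R → Ctx U RU → CForm V R → Prop
  | M, u, .prim X x => ∃ v, Solves M u v ∧ v X = x
  | M, u, .neg φ => ¬ Sat M u φ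
  | M, u, .conj φ ψ => Sat M u φ ∧ Sat M u ψ
  | M, u, .intv g φ => Sat (intervene M g) u φ

/-- AC1 and AC2 of the (updated) HP definition, with witnesses `W, w, xs'`:
`X⃗ = x⃗` (given by the set `Xs` of variables and values `xs`) is a weak cause of
`φ` in `(M,u)`. -/
def WeakCause (M : CausalModel U RU V R) (u : Ctx U RU)
    (Xs : Finset V) (xs : World V R) (φ : CForm V R)
    (W : Set V) (w : World V R) (xs' : World V R) : Prop :=
  -- AC1
  (∀ X ∈ Xs, Sat M u (.prim X (xs X))) ∧ Sat M u φ ∧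
  -- AC2: X⃗ is included in Z⃗ = Wᶜ
  Disjoint (↑Xs : Set V) W ∧
  ∀ zs : World V R, (∀ Z ∈ Wᶜ, Sat M u (.prim Z (zs Z))) →
    -- AC2(a)
    (Sat M u (.intv ((restrictTo (↑Xs) xs').union (restrictTo W w)) (.neg φ)) ∧
    -- AC2(b)
    ∀ W' ⊆ W, ∀ Z' ⊆ Wᶜ,
      Sat M u (.intv (((restrictTo (↑Xs) xs).union (restrictTo W' w)).union
        (restrictTo Z' zs)) φ))

/-- The (updated) HP definition of actual cause: AC1, AC2 (for some witness), and
the minimality condition AC3. -/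
def ActualCause (M : CausalModel U RU V R) (u : Ctx U RU)
    (Xs : Finset V) (xs : World V R) (φ : CForm V R) : Prop :=
  (∃ W w xs', WeakCause M u Xs xs φ W w xs') ∧
  ∀ Ys : Finset V, Ys ⊂ Xs → ¬ ∃ W w xs', WeakCause M u Ys xs φ W w xs'

/-- The endogenous variables of the voting/scanner example. -/
inductive VoteVar : Type where
  | A | B | C1 | C2 | WIN
deriving DecidableEq

/-- The causal model of the voting/scanner example: one exogenous variable whose
value (a pair of Booleans) directly determines `A` and `B`; `C₁ = min(A,B)`,
`C₂ = min(A,B)`, and `WIN = 1` iff `A = 1` or (`C₁ = 1` and `C₂ = 1`). -/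
def voteModel : CausalModel Unit (fun _ => Bool × Bool) VoteVar (fun _ => Bool) where
  F := fun X u v =>
    match X with
    | .A => (u ()).1
    | .B => (u ()).2
    | .C1 => v .A && v .B
    | .C2 => v .A && v .B
    | .WIN => v .A || (v .C1 && v .C2)

/-- The context in which `A = 1` and `B = 1`. -/
def voteCtx : Ctx Unit (fun _ => Bool × Bool) := fun _ => (true, true)

/-- The solution of the voting model in `voteCtx` under the intervention `g`. -/
def voteSolution (g : PAssign VoteVar (fun _ => Bool)) : World VoteVar (fun _ => Bool) :=
  let a := (g .A).getD true
  let b := (g .B).getD true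
  let c₁ := (g .C1).getD (a && b)
  let c₂ := (g .C2).getD (a && b)
  fun X => match X with
    | .A => a
    | .B => b
    | .C1 => c₁
    | .C2 => c₂
    | .WIN => (g .WIN).getD (a || (c₁ && c₂))

theorem Option.elim_id_eq_getD {α : Type} (o : Option α) (d : α) : o.elim d id = o.getD d := by
  cases o <;> rfl

theorem solves_intervene_voteModel_iff (g : PAssign VoteVar (fun _ => Bool))
    (v : World VoteVar (fun _ => Bool)) :
    Solves (intervene voteModel g) voteCtx v ↔ v = voteSolution g := by
  constructor
  · intro h
    have hA := h .A
    have hB := h .B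
    have h1 := h .C1
    have h2 := h .C2
    have hW := h .WIN
    simp only [intervene, voteModel, voteCtx, Option.elim_id_eq_getD] at hA hB h1 h2 hW
    funext X
    cases X <;> simp only [voteSolution]
    · exact hA
    · exact hB
    · rw [h1, hA, hB]
    · rw [h2, hA, hB]
    · rw [hW, h1, h2, hA, hB]
  · rintro rfl X
    cases X <;> simp only [intervene, voteModel, voteCtx, Option.elim_id_eq_getD, voteSolution]

theorem sat_intervene_voteModel_prim_iff (g : PAssign VoteVar (fun _ => Bool))
    (X : VoteVar) (x : Bool) :
    Sat (intervene voteModel g) voteCtx (.prim X x) ↔ voteSolution g X = x := by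
  simp only [Sat, solves_intervene_voteModel_iff, exists_eq_left]

theorem sat_voteModel_prim_iff (X : VoteVar) (x : Bool) :
    Sat voteModel voteCtx (.prim X x) ↔ x = true := by
  have h := sat_intervene_voteModel_prim_iff (fun _ => none) X x
  have hX : voteSolution (fun _ => none) X = true := by cases X <;> rfl
  rw [hX] at h
  exact h.trans eq_comm

theorem weakCause_C1_C2 :
    WeakCause voteModel voteCtx {VoteVar.C1, VoteVar.C2} (fun _ => true) (.prim VoteVar.WIN true)
      {VoteVar.A} (fun _ => false) (fun _ => false) := by
  refine ⟨fun X _ => (sat_voteModel_prim_iff X _).2 rfl, (sat_voteModel_prim_iff _ _).2 rfl,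
    by simp, fun zs hzs => ⟨?_, fun W' hW' Z' hZ' => ?_⟩⟩
  · simp [Sat.eq_4, Sat.eq_2, sat_intervene_voteModel_prim_iff, voteSolution, PAssign.union,
      restrictTo]
  · have hWIN : VoteVar.WIN ∉ W' := fun h => by simpa using hW' h
    have hz : zs .WIN = true := (sat_voteModel_prim_iff _ _).1 (hzs .WIN (by simp))
    rw [Sat.eq_4, sat_intervene_voteModel_prim_iff]
    by_cases h : VoteVar.WIN ∈ Z' <;>
      simp [voteSolution, PAssign.union, restrictTo, hWIN, hz, h]

theorem not_weakCause_empty (W : Set VoteVar) (w xs' : World VoteVar (fun _ => Bool)) :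
    ¬ WeakCause voteModel voteCtx ∅ (fun _ => true) (.prim VoteVar.WIN true) W w xs' := by
  rintro ⟨-, -, -, h⟩
  obtain ⟨ha, hb⟩ := h (fun _ => true) fun Z _ => (sat_voteModel_prim_iff Z _).2 rfl
  have hb := hb W subset_rfl ∅ (Set.empty_subset _)
  simp only [Sat.eq_4, Sat.eq_2, sat_intervene_voteModel_prim_iff] at ha hb
  apply ha
  simpa [voteSolution, PAssign.union, restrictTo] using hb

theorem not_weakCause_singleton {C : VoteVar} (hC : C = .C1 ∨ C = .C2) (W : Set VoteVar)
    (w xs' : World VoteVar (fun _ => Bool)) :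
    ¬ WeakCause voteModel voteCtx {C} (fun _ => true) (.prim VoteVar.WIN true) W w xs' := by
  rintro ⟨-, -, -, h⟩
  obtain ⟨ha, hb⟩ := h (fun _ => true) fun Z _ => (sat_voteModel_prim_iff Z _).2 rfl
  have hWb := hb W subset_rfl ∅ (Set.empty_subset _)
  have hAb := fun hA : VoteVar.A ∈ W =>
    hb {.A} (Set.singleton_subset_iff.2 hA) ∅ (Set.empty_subset _)
  simp only [Sat.eq_4, Sat.eq_2, sat_intervene_voteModel_prim_iff] at ha hWb hAb
  by_cases hA : VoteVar.A ∈ W <;> by_cases hWIN : VoteVar.WIN ∈ W <;>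
    rcases hC with rfl | rfl <;>
    simp_all [voteSolution, PAssign.union, restrictTo]

/-- in the voting/scanner model, `C₁ = 1 ∧ C₂ = 1` is an actual cause
of `WIN = 1` in `(M,u⃗)` according to the HP definition, but neither `C₁ = 1` alone
nor `C₂ = 1` alone is; hence a cause according to the HP definition need not be a
single conjunct. -/
theorem vote_conjunctive_cause :
    ActualCause voteModel voteCtx {VoteVar.C1, VoteVar.C2} (fun _ => true)
      (.prim VoteVar.WIN true) ∧
    ¬ ActualCause voteModel voteCtx {VoteVar.C1} (fun _ => true)
      (.prim VoteVar.WIN true) ∧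
    ¬ ActualCause voteModel voteCtx {VoteVar.C2} (fun _ => true)
      (.prim VoteVar.WIN true) := by
  refine ⟨⟨⟨_, _, _, weakCause_C1_C2⟩, ?_⟩, ?_, ?_⟩
  · rintro Ys hYs ⟨W, w, xs', h⟩
    have hcases : Ys = ∅ ∨ Ys = {VoteVar.C1} ∨ Ys = {VoteVar.C2} := by
      have hsub : (Ys : Set VoteVar) ⊆ {VoteVar.C1, VoteVar.C2} := by
        simpa using Finset.coe_subset.2 hYs.subset
      rcases Set.subset_pair_iff_eq.1 hsub with h | h | h | h
      · exact .inl (by exact_mod_cast h)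
      · exact .inr (.inl (by exact_mod_cast h))
      · exact .inr (.inr (by exact_mod_cast h))
      · exact absurd (by exact_mod_cast h) hYs.ne
    rcases hcases with rfl | rfl | rfl
    · exact not_weakCause_empty _ _ _ h
    · exact not_weakCause_singleton (.inl rfl) _ _ _ h
    · exact not_weakCause_singleton (.inr rfl) _ _ _ h
  · rintro ⟨⟨W, w, xs', h⟩, -⟩
    exact not_weakCause_singleton (.inl rfl) _ _ _ h
  · rintro ⟨⟨W, w, xs', h⟩, -⟩
    exact not_weakCause_singleton (.inr rfl) _ _ _ h
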